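/- arXiv:1602.01020 — 2 statements merged into one kernel-verified Lean document; each statement's English description precedes it below -/
import Mathlib

section
/- Let $K$ be a convex body in $\mathbb{R}^d$, $d \ge 2$, let $0 \le k \le d-2$, and let $\mathcal{K} = \{x_i + \tau_i K : i=1,\dots,n\}$, $\tau_i > 0$, be a $k$-impassable family of positive homothets of $K$. Then there exists $z \in \mathbb{R}^d$ such that $\bigcup \mathcal{K} \subseteq z + \left(\sum_{i=1}^n \tau_i\right) K$. -/
open scoped Pointwise

open Set Filter Topology MeasureTheory in
theorem aux_mono {n : ℕ} (k f : ℝ → ℝ) (hk : ConvexOn ℝ univ k) (hf : ConvexOn ℝ univ f)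
    (b τ : Fin n → ℝ) (hτ : ∀ i, 0 < τ i)
    (H : ∀ r p, (∀ y, f r + p * (y - r) ≤ f y) →
      ∃ i q, p = b i + τ i * q ∧ ∀ y, k r + q * (y - r) ≤ k y) {s t : ℝ} (hst : s ≤ t) :
    derivWithin f (Ioi t) t - derivWithin f (Ioi s) s ≤
      (∑ i, τ i) * (derivWithin k (Ioi t) t - derivWithin k (Ioi s) s) := by
  rcases hst.eq_or_lt with rfl | hst
  · simp
  have hI : ∀ x : ℝ, x ∈ interior (univ : Set ℝ) := fun x => by simp
  have hkm : derivWithin k (Ioi s) s ≤ derivWithin k (Ioi t) t :=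
    hk.monotoneOn_rightDeriv (hI s) (hI t) hst.le
  set α := derivWithin k (Ioi s) s with hα
  set β := derivWithin k (Ioi t) t with hβ
  set A := derivWithin f (Ioi s) s with hA
  set B := derivWithin f (Ioi t) t with hB
  have hfc : Continuous f := by
    rw [← continuousOn_univ]; exact hf.continuousOn isOpen_univ
  have hcov : Ioo A B ⊆ ⋃ i, Icc (b i + τ i * α) (b i + τ i * β) := by
    rintro p ⟨hp1, hp2⟩
    have hφc : Continuous (fun y => f y - p * y) := by fun_prop
    obtain ⟨r, hr, hrmin⟩ := isCompact_Icc.exists_isMinOn (nonempty_Icc.2 hst.le) hφc.continuousOn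
    have hrmin' : ∀ y ∈ Icc s t, f r - p * r ≤ f y - p * y := fun y hy => hrmin hy
    have hsr : s < r := by
      rcases hr.1.eq_or_lt with h | h
      · exfalso
        have h1 := (hf.hasDerivWithinAt_rightDeriv_of_mem_interior (hI s))
        rw [hasDerivWithinAt_iff_tendsto_slope' (by simp)] at h1
        have h2 := h1.eventually (gt_mem_nhds hp1)
        have h3 : ∀ᶠ y in 𝓝[>] s, y ∈ Ioo s t := Ioo_mem_nhdsGT hst
        obtain ⟨y, hy1, hy2⟩ := (h2.and h3).exists
        have := hrmin' y ⟨hy2.1.le, hy2.2.le⟩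
        rw [← h] at this
        rw [slope_def_field, div_lt_iff₀ (by linarith [hy2.1])] at hy1
        linarith
      · exact h
    have hsub : ∀ y, f r + p * (y - r) ≤ f y := by
      have hφ : ConvexOn ℝ univ (fun y => f y - p * y) := by
        have h : ConvexOn ℝ univ (fun y : ℝ => (-p) * y) :=
          (LinearMap.mul ℝ ℝ (-p)).convexOn convex_univ
        have h2 := hf.add h
        refine h2.congr ?_
        intro y _; simp [sub_eq_add_neg]
      have hloc : IsLocalMin (fun y => f y - p * y) r := by
        filter_upwards [Ioi_mem_nhds hsr] with y hy
        rcases le_or_gt y t with hyt | hyt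
        · exact hrmin' y ⟨le_of_lt hy, hyt⟩
        · have h1 := hf.rightDeriv_le_slope_of_mem_interior (hI t) (mem_univ y) hyt
          have h2 : p < slope f t y := lt_of_lt_of_le hp2 h1
          rw [slope_def_field, lt_div_iff₀ (by linarith)] at h2
          have := hrmin' t ⟨hst.le, le_rfl⟩
          linarith
      intro y
      have := IsMinOn.of_isLocalMin_of_convex_univ hloc hφ y
      linarith
    obtain ⟨i, q, hpq, hq⟩ := H r p hsub
    have h1 : α ≤ q := by
      refine (hk.rightDeriv_le_slope_of_mem_interior (hI s) (mem_univ r) hsr).trans ?_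
      rw [slope_def_field, div_le_iff₀ (by linarith)]
      linarith [hq s]
    have h2 : q ≤ β := by
      refine le_trans ?_ (hk.monotoneOn_rightDeriv (hI r) (hI t) hr.2)
      have h1 := (hk.hasDerivWithinAt_rightDeriv_of_mem_interior (hI r))
      rw [hasDerivWithinAt_iff_tendsto_slope' (by simp)] at h1
      refine ge_of_tendsto h1 ?_
      filter_upwards [self_mem_nhdsWithin] with y hy
      have hy : r < y := hy
      rw [slope_def_field, le_div_iff₀ (by linarith)]
      linarith [hq y]
    refine mem_iUnion.2 ⟨i, ?_, ?_⟩
    · rw [hpq]; gcongr; exact (hτ i).le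
    · rw [hpq]; gcongr; exact (hτ i).le
  have hvol := (measure_mono (μ := volume) hcov).trans (measure_iUnion_fintype_le _ _)
  simp only [Real.volume_Ioo, Real.volume_Icc] at hvol
  have hnn : ∀ i ∈ (Finset.univ : Finset (Fin n)), 0 ≤ (b i + τ i * β) - (b i + τ i * α) := by
    intro i _
    nlinarith [mul_le_mul_of_nonneg_left hkm (hτ i).le]
  rw [← ENNReal.ofReal_sum_of_nonneg hnn,
    ENNReal.ofReal_le_ofReal_iff (Finset.sum_nonneg hnn)] at hvol
  refine hvol.trans (le_of_eq ?_)
  rw [Finset.sum_mul]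
  exact Finset.sum_congr rfl fun i _ => by ring

open Set Filter Topology in
theorem aux_convex_of_rightDeriv (g D : ℝ → ℝ) (hg : Continuous g)
    (hD : ∀ x, HasDerivWithinAt g (D x) (Ici x) x) (hm : Monotone D) : ConvexOn ℝ univ g := by
  refine convexOn_of_slope_mono_adjacent convex_univ ?_
  intro x y z _ _ hxy hyz
  have h1 : g y ≤ g x + D y * (y - x) := by
    refine image_le_of_deriv_right_le_deriv_boundary (f := g) (f' := D) (a := x) (b := y)
      (B := fun w => g x + D y * (w - x)) (B' := fun _ => D y)
      hg.continuousOn (fun w _ => hD w) (by simp) (by fun_prop) ?_ ?_ ⟨hxy.le, le_rfl⟩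
    · intro w _
      have : HasDerivAt (fun w => g x + D y * (w - x)) (D y * 1) w :=
        (((hasDerivAt_id w).sub_const x).const_mul (D y)).const_add (g x)
      simpa using this.hasDerivWithinAt
    · intro w hw; exact hm hw.2.le
  have h2 : g y + D y * (z - y) ≤ g z := by
    refine image_le_of_deriv_right_le_deriv_boundary (B := g) (B' := D) (a := y) (b := z)
      (f := fun w => g y + D y * (w - y)) (f' := fun _ => D y)
      (by fun_prop) ?_ (by simp) hg.continuousOn (fun w _ => hD w) ?_ ⟨hyz.le, le_rfl⟩
    · intro w _
      have : HasDerivAt (fun w => g y + D y * (w - y)) (D y * 1) w :=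
        (((hasDerivAt_id w).sub_const y).const_mul (D y)).const_add (g y)
      simpa using this.hasDerivWithinAt
    · intro w hw; exact hm hw.1
  have h3 : (g y - g x) / (y - x) ≤ D y := by
    rw [div_le_iff₀ (by linarith)]; linarith
  have h4 : D y ≤ (g z - g y) / (z - y) := by
    rw [le_div_iff₀ (by linarith)]; linarith
  exact h3.trans h4

open Set Filter Topology in
theorem aux_convex {n : ℕ} (k f : ℝ → ℝ) (hk : ConvexOn ℝ univ k) (hf : ConvexOn ℝ univ f)
    (b τ : Fin n → ℝ) (hτ : ∀ i, 0 < τ i)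
    (H : ∀ r p, (∀ y, f r + p * (y - r) ≤ f y) →
      ∃ i q, p = b i + τ i * q ∧ ∀ y, k r + q * (y - r) ≤ k y) :
    ConvexOn ℝ univ (fun t => (∑ i, τ i) * k t - f t) := by
  have hI : ∀ x : ℝ, x ∈ interior (univ : Set ℝ) := fun x => by simp
  have hfc : Continuous f := by
    rw [← continuousOn_univ]; exact hf.continuousOn isOpen_univ
  have hkc : Continuous k := by
    rw [← continuousOn_univ]; exact hk.continuousOn isOpen_univ
  refine aux_convex_of_rightDeriv _
    (fun t => (∑ i, τ i) * derivWithin k (Ioi t) t - derivWithin f (Ioi t) t) (by fun_prop) ?_ ?_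
  · intro x
    exact ((hk.hasDerivWithinAt_rightDeriv_of_mem_interior (hI x)).Ici_of_Ioi.const_mul _).sub
      (hf.hasDerivWithinAt_rightDeriv_of_mem_interior (hI x)).Ici_of_Ioi
  · intro s t hst
    have := aux_mono k f hk hf b τ hτ H hst
    simp only
    linarith

/-- support function -/
noncomputable def auxH {E : Type*} [NormedAddCommGroup E] [InnerProductSpace ℝ E]
    (C : Set E) (w : E) : ℝ := sSup ((fun P => inner ℝ w P) '' C)

section
variable {E : Type*} [NormedAddCommGroup E] [InnerProductSpace ℝ E]

theorem auxH_max {C : Set E} (hC : IsCompact C) (hne : C.Nonempty) (w : E) :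
    ∃ P ∈ C, auxH C w = inner ℝ w P ∧ ∀ Q ∈ C, inner ℝ w Q ≤ inner ℝ w P :=
  hC.exists_sSup_image_eq_and_ge hne (by fun_prop)

theorem auxH_le {C : Set E} (hC : IsCompact C) {P : E} (hP : P ∈ C) (w : E) :
    inner ℝ w P ≤ auxH C w := by
  obtain ⟨Q, _, h1, h2⟩ := auxH_max hC ⟨P, hP⟩ w
  rw [h1]; exact h2 P hP

theorem auxH_smul {C : Set E} (hC : IsCompact C) (hne : C.Nonempty) {c : ℝ} (hc : 0 ≤ c) (w : E) :
    auxH C (c • w) = c * auxH C w := by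
  obtain ⟨P, hP, h1, -⟩ := auxH_max hC hne (c • w)
  obtain ⟨Q, hQ, h2, -⟩ := auxH_max hC hne w
  apply le_antisymm
  · rw [h1, real_inner_smul_left]
    exact mul_le_mul_of_nonneg_left (auxH_le hC hP w) hc
  · rw [h2, ← real_inner_smul_left]
    exact auxH_le hC hQ _

theorem auxH_line {C : Set E} (hC : IsCompact C) (hne : C.Nonempty) (u v : E) :
    ConvexOn ℝ Set.univ (fun t : ℝ => auxH C (u + t • v)) := by
  refine ⟨convex_univ, ?_⟩
  intro s _ t _ a b ha hb hab
  obtain ⟨P, hP, h1, -⟩ := auxH_max hC hne (u + (a • s + b • t) • v)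
  simp only [h1]
  have h2 := mul_le_mul_of_nonneg_left (auxH_le hC hP (u + s • v)) ha
  have h3 := mul_le_mul_of_nonneg_left (auxH_le hC hP (u + t • v)) hb
  simp only [inner_add_left, real_inner_smul_left, smul_eq_mul] at *
  have : inner ℝ u P = (a + b) * inner ℝ u P := by rw [hab, one_mul]
  linarith

open Filter Topology in
theorem aux_face {C : Set E} (hC : IsCompact C) (hne : C.Nonempty) (w v : E) (p : ℝ)
    (h : ∀ t : ℝ, 0 < t → auxH C w + p * t ≤ auxH C (w + t • v)) :
    ∃ P ∈ C, inner ℝ w P = auxH C w ∧ p ≤ inner ℝ v P := by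
  choose P hP h1 h2 using fun n : ℕ => auxH_max hC hne (w + (1 / ((n : ℝ) + 1)) • v)
  obtain ⟨Q, hQ, φ, hφ, hlim⟩ := hC.tendsto_subseq hP
  have hpos : ∀ n : ℕ, 0 < 1 / ((n : ℝ) + 1) := fun n => by positivity
  have key : ∀ n : ℕ, auxH C w + p * (1 / ((n : ℝ) + 1)) ≤
      inner ℝ w (P n) + (1 / ((n : ℝ) + 1)) * inner ℝ v (P n) := by
    intro n
    have := h _ (hpos n)
    rw [h1, inner_add_left, real_inner_smul_left] at this
    exact this
  have hv : ∀ n, p ≤ inner ℝ v (P n) := by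
    intro n
    have := key n
    have h3 := auxH_le hC (hP n) w
    have h4 : p * (1 / ((n : ℝ) + 1)) ≤ inner ℝ v (P n) * (1 / ((n : ℝ) + 1)) := by linarith
    exact le_of_mul_le_mul_right h4 (hpos n)
  have lv : Tendsto (fun n => inner ℝ v (P (φ n))) atTop (𝓝 (inner ℝ v Q)) :=
    tendsto_const_nhds.inner hlim
  have lw : Tendsto (fun n => inner ℝ w (P (φ n))) atTop (𝓝 (inner ℝ w Q)) :=
    tendsto_const_nhds.inner hlim
  have l0 : Tendsto (fun n => 1 / (((φ n : ℕ) : ℝ) + 1)) atTop (𝓝 0) :=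
    (tendsto_one_div_add_atTop_nhds_zero_nat (𝕜 := ℝ)).comp hφ.tendsto_atTop
  refine ⟨Q, hQ, le_antisymm (auxH_le hC hQ w) ?_, ge_of_tendsto' lv fun n => hv _⟩
  have L := le_of_tendsto_of_tendsto' ((l0.const_mul p).const_add (auxH C w))
    (lw.add (l0.mul lv)) fun n => key (φ n)
  simpa using L

theorem aux_face2 {C : Set E} (hC : IsCompact C) (hne : C.Nonempty) (w v : E) (p : ℝ)
    (h : ∀ t : ℝ, auxH C w + p * t ≤ auxH C (w + t • v)) :
    ∃ P ∈ convexHull ℝ C, inner ℝ w P = auxH C w ∧ inner ℝ v P = p := by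
  obtain ⟨P, hP, hP1, hP2⟩ := aux_face hC hne w v p fun t _ => h t
  obtain ⟨Q, hQ, hQ1, hQ2⟩ := aux_face hC hne w (-v) (-p) fun t _ => by
    have := h (-t)
    simpa using this
  rw [inner_neg_left] at hQ2
  have hQ2 : inner ℝ v Q ≤ p := by linarith
  have hmem : p ∈ segment ℝ (inner ℝ v Q : ℝ) (inner ℝ v P) := by
    rw [segment_eq_Icc (hQ2.trans hP2)]; exact ⟨hQ2, hP2⟩
  obtain ⟨a, b, ha, hb, hab, hp⟩ := hmem
  refine ⟨a • Q + b • P, ?_, ?_, ?_⟩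
  · exact (convex_convexHull ℝ C) (subset_convexHull ℝ C hQ) (subset_convexHull ℝ C hP) ha hb hab
  · rw [inner_add_right, real_inner_smul_right, real_inner_smul_right, hP1, hQ1, ← add_mul, hab,
      one_mul]
  · rw [inner_add_right, real_inner_smul_right, real_inner_smul_right]
    exact hp

end

theorem aux_subspace (d k : ℕ) (hk : k + 2 ≤ d) (u v : EuclideanSpace ℝ (Fin d)) :
    ∃ W : Submodule ℝ (EuclideanSpace ℝ (Fin d)), Module.finrank ℝ W = k ∧
      ∀ y ∈ W, inner ℝ u y = 0 ∧ inner ℝ v y = 0 := by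
  classical
  set S := Submodule.span ℝ ({u, v} : Set (EuclideanSpace ℝ (Fin d))) with hS
  have h1 : Module.finrank ℝ S ≤ 2 := by
    have h := finrank_span_finset_le_card (R := ℝ) ({u, v} : Finset (EuclideanSpace ℝ (Fin d)))
    have h2 := Finset.card_le_two (a := u) (b := v)
    rw [Finset.coe_insert, Finset.coe_singleton] at h
    exact h.trans h2
  have h2 := S.finrank_add_finrank_orthogonal
  rw [finrank_euclideanSpace_fin] at h2
  have h3 : k ≤ Module.finrank ℝ Sᗮ := by omega
  obtain ⟨f, hf⟩ := exists_linearIndependent_of_le_finrank (R := ℝ) h3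
  have hf' : LinearIndependent ℝ (fun i => (f i : EuclideanSpace ℝ (Fin d))) :=
    hf.map' Sᗮ.subtype (Submodule.ker_subtype _)
  refine ⟨Submodule.span ℝ (Set.range fun i => (f i : EuclideanSpace ℝ (Fin d))), ?_, ?_⟩
  · rw [finrank_span_eq_card hf', Fintype.card_fin]
  · intro y hy
    have hle : Submodule.span ℝ (Set.range fun i => (f i : EuclideanSpace ℝ (Fin d))) ≤ Sᗮ := by
      rw [Submodule.span_le]; rintro _ ⟨i, rfl⟩; exact (f i).2
    have hy := (Submodule.mem_orthogonal S y).1 (hle hy)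
    exact ⟨hy u (Submodule.subset_span (by simp)), hy v (Submodule.subset_span (by simp))⟩

/-- Goodman–Goodman for `k`-impassable families: if `{x i + τ i • K}` is a `k`-impassable
family of positive homothets of a convex body `K ⊆ ℝ^d` with `0 ≤ k ≤ d - 2`, then the
union is covered by a translate of `(∑ τ i) • K`. -/
theorem stmt_14 (d k n : ℕ) (hd : 2 ≤ d) (hk : k + 2 ≤ d) (hn : 1 ≤ n)
    (K : Set (EuclideanSpace ℝ (Fin d)))
    (hKc : IsCompact K) (hKconv : Convex ℝ K) (hKint : (interior K).Nonempty)
    (x : Fin n → EuclideanSpace ℝ (Fin d)) (τ : Fin n → ℝ) (hτ : ∀ i, 0 < τ i)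
    (hIP : ∀ A : AffineSubspace ℝ (EuclideanSpace ℝ (Fin d)),
      Module.finrank ℝ A.direction = k →
      ((A : Set (EuclideanSpace ℝ (Fin d))) ∩ convexHull ℝ (⋃ i, x i +ᵥ τ i • K)).Nonempty →
      ∃ i, ((A : Set (EuclideanSpace ℝ (Fin d))) ∩ (x i +ᵥ τ i • K)).Nonempty) :
    ∃ z : EuclideanSpace ℝ (Fin d), (⋃ i, x i +ᵥ τ i • K) ⊆ z +ᵥ (∑ i, τ i) • K := by
  have hKne : K.Nonempty := hKint.mono interior_subset
  set U := ⋃ i, x i +ᵥ τ i • K with hU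
  have hUc : IsCompact U := isCompact_iUnion fun i => (hKc.smul (τ i)).vadd (x i)
  have hmemU : ∀ i, ∀ q ∈ K, x i + τ i • q ∈ U := fun i q hq =>
    Set.mem_iUnion.2 ⟨i, Set.vadd_mem_vadd_set (Set.smul_mem_smul_set hq)⟩
  have hUne : U.Nonempty := by
    obtain ⟨q, hq⟩ := hKne
    exact ⟨_, hmemU ⟨0, by omega⟩ q hq⟩
  set T := ∑ i, τ i with hT
  have hTpos : 0 < T := Finset.sum_pos (fun i _ => hτ i) ⟨⟨0, by omega⟩, Finset.mem_univ _⟩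
  have hline : ∀ u v : EuclideanSpace ℝ (Fin d), ConvexOn ℝ Set.univ
      (fun t : ℝ => T * auxH K (u + t • v) - auxH U (u + t • v)) := by
    intro u v
    refine aux_convex _ _ (auxH_line hKc hKne u v) (auxH_line hUc hUne u v)
      (fun i => inner ℝ v (x i)) τ hτ ?_
    intro r p hp
    obtain ⟨P, hP, hP1, hP2⟩ := aux_face2 hUc hUne (u + r • v) v p fun t => by
      have := hp (r + t)
      rw [add_sub_cancel_left, add_smul, ← add_assoc] at this
      exact this
    obtain ⟨W, hW, hWorth⟩ := aux_subspace d k hk u v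
    obtain ⟨i, Q, hQA, hQ⟩ := hIP (AffineSubspace.mk' P W) (by rw [AffineSubspace.direction_mk']; exact hW)
      ⟨P, AffineSubspace.self_mem_mk' _ _, hP⟩
    have hQW := (AffineSubspace.mem_mk').1 hQA
    obtain ⟨hu, hv⟩ := hWorth _ hQW
    rw [vsub_eq_sub, inner_sub_right, sub_eq_zero] at hu hv
    obtain ⟨_, ⟨q, hq, rfl⟩, rfl⟩ := hQ
    simp only [vadd_eq_add] at hu hv
    have hqmax : auxH K (u + r • v) = inner ℝ (u + r • v) q := by
      obtain ⟨q', hq', h1, -⟩ := auxH_max hKc hKne (u + r • v)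
      apply le_antisymm _ (auxH_le hKc hq _)
      rw [h1]
      have h2 := auxH_le hUc (hmemU i q' hq') (u + r • v)
      have h3 : inner ℝ (u + r • v) (x i + τ i • q) = auxH U (u + r • v) := by
        rw [← hP1, inner_add_left, inner_add_left, hu, real_inner_smul_left, hv,
          real_inner_smul_left]
      rw [← h3, inner_add_right, inner_add_right _ (x i), real_inner_smul_right,
        real_inner_smul_right] at h2
      exact le_of_mul_le_mul_left (by linarith) (hτ i)
    refine ⟨i, inner ℝ v q, ?_, ?_⟩
    · rw [← hP2, ← hv, inner_add_right, real_inner_smul_right]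
    · intro y
      simp only [hqmax]
      refine le_trans (le_of_eq ?_) (auxH_le hKc hq (u + y • v))
      simp only [inner_add_left, real_inner_smul_left]
      ring
  obtain ⟨ℓ, -, hℓ⟩ := exists_extension_of_le_sublinear
    (⊥ : EuclideanSpace ℝ (Fin d) →ₗ.[ℝ] ℝ) (fun w => T * auxH K w - auxH U w)
    (fun c hc w => by
      simp only [auxH_smul hKc hKne hc.le, auxH_smul hUc hUne hc.le]; ring)
    (fun a b => by
      have h := (hline a (b - a)).right (Set.mem_univ 0) (Set.mem_univ 1)
        (by norm_num : (0:ℝ) ≤ 1/2) (by norm_num : (0:ℝ) ≤ 1/2) (by norm_num)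
      have e : a + ((1/2 : ℝ) • (0:ℝ) + (1/2 : ℝ) • (1:ℝ)) • (b - a) = (1/2 : ℝ) • (a + b) := by
        simp only [smul_eq_mul]
        module
      simp only [e] at h
      rw [auxH_smul hKc hKne (by norm_num), auxH_smul hUc hUne (by norm_num)] at h
      simp only [zero_smul, add_zero, one_smul, add_sub_cancel, smul_eq_mul] at h
      linarith)
    (fun w => by
      have hw : (w : EuclideanSpace ℝ (Fin d)) = 0 := by
        exact (Submodule.mem_bot ℝ).1 w.2
      have h0 : w = 0 := Subtype.ext hw
      rw [h0]
      have h1 := auxH_smul hKc hKne le_rfl (0 : EuclideanSpace ℝ (Fin d))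
      have h2 := auxH_smul hUc hUne le_rfl (0 : EuclideanSpace ℝ (Fin d))
      simp only [smul_zero, zero_mul] at h1 h2
      simp [h1, h2])
  set z := (InnerProductSpace.toDual ℝ (EuclideanSpace ℝ (Fin d))).symm
    (LinearMap.toContinuousLinearMap ℓ) with hz
  have hzl : ∀ w, inner ℝ z w = ℓ w := fun w => by
    rw [hz, InnerProductSpace.toDual_symm_apply]; rfl
  refine ⟨-z, ?_⟩
  intro P hP
  rw [Set.mem_vadd_set_iff_neg_vadd_mem, neg_neg, vadd_eq_add]
  by_contra hcon
  obtain ⟨g, c, hg1, hg2⟩ := geometric_hahn_banach_closed_point (hKconv.smul T)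
    (hKc.smul T).isClosed hcon
  set w := (InnerProductSpace.toDual ℝ (EuclideanSpace ℝ (Fin d))).symm g with hw
  have hwg : ∀ y, inner ℝ w y = g y := fun y => by
    rw [hw, InnerProductSpace.toDual_symm_apply]
  obtain ⟨q, hq, h1, -⟩ := auxH_max hKc hKne w
  have h2 := hg1 _ (Set.smul_mem_smul_set (a := T) hq)
  have h3 := hℓ w
  have h4 := auxH_le hUc hP w
  rw [← hzl, real_inner_comm] at h3
  rw [← hwg, real_inner_smul_right, ← h1] at h2
  rw [← hwg, inner_add_right] at hg2
  linarith
end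

section
/- Let $x_i, t_i, y_i > 0$, $i=1,2,3$, satisfy $x_i + t_i + y_i = 1$ and the collinearity conditions $t_3 x_2 + x_1 y_3 - x_1 x_2 - y_2 y_3 = 0$, $t_1 x_3 + x_2 y_1 - x_2 x_3 - y_1 y_3 = 0$, $t_2 x_1 + x_3 y_2 - x_1 x_3 - y_1 y_2 = 0$. Then $t_1 + t_2 + t_3 \ge \frac{3(3-\sqrt 3)}{4} \cdot \min\left(1, \frac{4}{3(3-\sqrt{3})}\right)$; in particular, if additionally $t_1+t_2+t_3 < 1$, then $t_1 + t_2 + t_3 \ge \frac{3(3-\sqrt{3})}{4}$, i.e., $\frac{1}{t_1+t_2+t_3} \le \frac{2}{3} + \frac{2}{3\sqrt{3}}$. -/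
/-- The hypotheses, bundled: positivity, side lengths, and collinearity in factored form. -/
structure Cfg17 (x1 x2 x3 t1 t2 t3 y1 y2 y3 : ℝ) : Prop where
  hx1 : 0 < x1
  hx2 : 0 < x2
  hx3 : 0 < x3
  ht1 : 0 < t1
  ht2 : 0 < t2
  ht3 : 0 < t3
  hy1 : 0 < y1
  hy2 : 0 < y2
  hy3 : 0 < y3
  s1 : x1 + t1 + y1 = 1
  s2 : x2 + t2 + y2 = 1
  s3 : x3 + t3 + y3 = 1
  f1 : x2 * (t3 - y2) = (x1 - y2) * (x2 - y3)
  f2 : x3 * (t1 - y3) = (x2 - y3) * (x3 - y1)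
  f3 : x1 * (t2 - y1) = (x3 - y1) * (x1 - y2)
  hT : t1 + t2 + t3 < 1

theorem Cfg17.rot {x1 x2 x3 t1 t2 t3 y1 y2 y3 : ℝ}
    (h : Cfg17 x1 x2 x3 t1 t2 t3 y1 y2 y3) : Cfg17 x2 x3 x1 t2 t3 t1 y2 y3 y1 :=
  ⟨h.hx2, h.hx3, h.hx1, h.ht2, h.ht3, h.ht1, h.hy2, h.hy3, h.hy1, h.s2, h.s3, h.s1,
    h.f2, h.f3, h.f1, by linarith [h.hT]⟩

theorem Cfg17.zero {x1 x2 x3 t1 t2 t3 y1 y2 y3 : ℝ}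
    (h : Cfg17 x1 x2 x3 t1 t2 t3 y1 y2 y3) (h1 : x1 = y2) : False := by
  obtain ⟨hx1, hx2, hx3, ht1, ht2, ht3, hy1, hy2, hy3, s1, s2, s3, f1, f2, f3, hT⟩ := h
  subst h1
  have a : t3 - x1 = 0 := by
    have : x2 * (t3 - x1) = 0 := by rw [f1]; ring
    rcases mul_eq_zero.1 this with h | h <;> linarith
  have b : t2 - y1 = 0 := by
    have : x1 * (t2 - y1) = 0 := by rw [f3]; ring
    rcases mul_eq_zero.1 this with h | h <;> linarith
  linarith

theorem Cfg17.caseB {x1 x2 x3 t1 t2 t3 y1 y2 y3 : ℝ}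
    (h : Cfg17 x1 x2 x3 t1 t2 t3 y1 y2 y3) (h1 : y2 < x1) (h2 : x2 < y3) (h3 : x3 < y1) :
    False := by
  obtain ⟨hx1, hx2, hx3, ht1, ht2, ht3, hy1, hy2, hy3, s1, s2, s3, f1, f2, f3, hT⟩ := h
  have a : 0 < t1 - y3 := by
    have : 0 < x3 * (t1 - y3) := by
      rw [f2]; exact mul_pos_of_neg_of_neg (by linarith) (by linarith)
    exact (mul_pos_iff_of_pos_left hx3).1 this
  linarith

theorem Cfg17.caseA {x1 x2 x3 t1 t2 t3 y1 y2 y3 : ℝ}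
    (h : Cfg17 x1 x2 x3 t1 t2 t3 y1 y2 y3) (h1 : x1 < y2) (h2 : y3 < x2) (h3 : y1 < x3) :
    False := by
  obtain ⟨hx1, hx2, hx3, ht1, ht2, ht3, hy1, hy2, hy3, s1, s2, s3, f1, f2, f3, hT⟩ := h
  have hg : 0 < t1 - y3 := by
    have : 0 < x3 * (t1 - y3) := by
      rw [f2]; exact mul_pos (by linarith) (by linarith)
    exact (mul_pos_iff_of_pos_left hx3).1 this
  have ha : 0 < y2 - t3 := by
    have : 0 < x2 * (y2 - t3) := by
      have := mul_pos (sub_pos.2 h1) (sub_pos.2 h2)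
      linarith
    exact (mul_pos_iff_of_pos_left hx2).1 this
  obtain ⟨δ, hδ⟩ : ∃ δ, δ = 1 - (t1 + t2 + t3) := ⟨_, rfl⟩
  have hδ0 : 0 < δ := by linarith
  -- `b = y1 - t2`, `a = y2 - t3`
  have e3 : y3 * (y2 - t3) = (x2 - y3) * (y1 - t2 - δ) := by
    have : x1 - y2 = δ - (y2 - t3) - (y1 - t2) := by linarith
    rw [this] at f1
    linarith
  have e1 : y1 * (t1 - y3) = (x3 - y1) * (δ - (y2 - t3)) := by
    have : x2 - y3 = δ - (y2 - t3) + (t1 - y3) := by linarith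
    rw [this] at f2
    linarith
  have hb : 0 < y1 - t2 - δ := by
    have := mul_pos hy3 ha
    rw [e3] at this
    exact (mul_pos_iff_of_pos_left (by linarith)).1 this
  have ha' : 0 < δ - (y2 - t3) := by
    have := mul_pos hy1 hg
    rw [e1] at this
    exact (mul_pos_iff_of_pos_left (by linarith)).1 this
  have e4 : t2 * (t1 - y3) = (t1 - y3) * (δ - (y2 - t3) - (y1 - t2))
      - (y1 - t2 - δ) * (δ - (y2 - t3)) := by
    have : x3 - y1 = (t1 - y3) - (y1 - t2) + δ := by linarith
    rw [this] at e1
    linarith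
  have p1 := mul_pos ht2 hg
  have p2 := mul_pos hb ha'
  have p3 : 0 < (t1 - y3) * ((y2 - t3) + (y1 - t2) - δ) := mul_pos hg (by linarith)
  linarith

theorem Cfg17.caseNeg {x1 x2 x3 t1 t2 t3 y1 y2 y3 : ℝ}
    (h : Cfg17 x1 x2 x3 t1 t2 t3 y1 y2 y3) (h1 : x1 < y2) (h2 : x2 < y3) (h3 : x3 < y1) :
    False := by
  obtain ⟨hx1, hx2, hx3, ht1, ht2, ht3, hy1, hy2, hy3, s1, s2, s3, f1, f2, f3, hT⟩ := h
  have hg : 0 < t1 - y3 := by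
    have : 0 < x3 * (t1 - y3) := by
      rw [f2]; exact mul_pos_of_neg_of_neg (by linarith) (by linarith)
    exact (mul_pos_iff_of_pos_left hx3).1 this
  have hg1 : 0 < t3 - y2 := by
    have : 0 < x2 * (t3 - y2) := by
      rw [f1]; exact mul_pos_of_neg_of_neg (by linarith) (by linarith)
    exact (mul_pos_iff_of_pos_left hx2).1 this
  have hg2 : 0 < t2 - y1 := by
    have : 0 < x1 * (t2 - y1) := by
      rw [f3]; exact mul_pos_of_neg_of_neg (by linarith) (by linarith)
    exact (mul_pos_iff_of_pos_left hx1).1 this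
  linarith

/-- The inequality for the main case. -/
theorem main_ineq17 (a b c d : ℝ) (ha : 0 < a) (hb : 0 < b) (hc : 0 < c) (hd : 0 < d) :
    (a + b + c) + 6 * d + 9 * d ^ 2 / (a + b + c) ≤
      (a + d) * (b + d) / c + (b + d) * (c + d) / a + (c + d) * (a + d) / b := by
  have i1 : a + b + c ≤ a * b / c + b * c / a + c * a / b := by
    have : a * b / c + b * c / a + c * a / b - (a + b + c) =
        ((a*b - b*c)^2 + (b*c - c*a)^2 + (c*a-a*b)^2) / (2 * (a * b * c)) := by
      field_simp; ring
    have h2 : 0 ≤ ((a*b - b*c)^2 + (b*c - c*a)^2 + (c*a-a*b)^2) / (2 * (a * b * c)) := by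
      positivity
    linarith
  have i2 : 6 ≤ (a + b) / c + (b + c) / a + (c + a) / b := by
    have : (a + b) / c + (b + c) / a + (c + a) / b - 6 =
        (a * (b - c)^2 + b * (c - a)^2 + c * (a - b)^2) / (a * b * c) := by
      field_simp; ring
    have h2 : 0 ≤ (a * (b - c)^2 + b * (c - a)^2 + c * (a - b)^2) / (a * b * c) := by
      positivity
    linarith
  have i3 : 9 / (a + b + c) ≤ 1 / a + 1 / b + 1 / c := by
    have : 1 / a + 1 / b + 1 / c - 9 / (a + b + c) =
        (a * (b - c)^2 + b * (c - a)^2 + c * (a - b)^2) / (a * b * c * (a + b + c)) := by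
      field_simp; ring
    have h2 : 0 ≤ (a * (b - c)^2 + b * (c - a)^2 + c * (a - b)^2) /
        (a * b * c * (a + b + c)) := by
      positivity
    linarith
  have e : (a + d) * (b + d) / c + (b + d) * (c + d) / a + (c + d) * (a + d) / b =
      (a * b / c + b * c / a + c * a / b) + d * ((a + b) / c + (b + c) / a + (c + a) / b)
        + d ^ 2 * (1 / a + 1 / b + 1 / c) := by
    field_simp; ring
  have e' : 9 * d ^ 2 / (a + b + c) = d ^ 2 * (9 / (a + b + c)) := by ring
  rw [e, e']
  have j2 := mul_le_mul_of_nonneg_left i2 hd.le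
  have j3 := mul_le_mul_of_nonneg_left i3 (sq_nonneg d)
  linarith

theorem Cfg17.casePos {x1 x2 x3 t1 t2 t3 y1 y2 y3 : ℝ}
    (h : Cfg17 x1 x2 x3 t1 t2 t3 y1 y2 y3) (h1 : y2 < x1) (h2 : y3 < x2) (h3 : y1 < x3) :
    3 * (3 - Real.sqrt 3) / 4 ≤ t1 + t2 + t3 := by
  obtain ⟨hx1, hx2, hx3, ht1, ht2, ht3, hy1, hy2, hy3, s1, s2, s3, f1, f2, f3, hT⟩ := h
  obtain ⟨a, ha⟩ : ∃ a, a = t1 - y3 := ⟨_, rfl⟩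
  obtain ⟨c, hc⟩ : ∃ a, a = t3 - y2 := ⟨_, rfl⟩
  obtain ⟨b, hb⟩ : ∃ a, a = t2 - y1 := ⟨_, rfl⟩
  obtain ⟨d, hd⟩ : ∃ δ, δ = 1 - (t1 + t2 + t3) := ⟨_, rfl⟩
  have hd0 : 0 < d := by linarith
  have ha0 : 0 < a := by
    have : 0 < x3 * (t1 - y3) := by
      rw [f2]; exact mul_pos (by linarith) (by linarith)
    rw [ha]; exact (mul_pos_iff_of_pos_left hx3).1 this
  have hc0 : 0 < c := by
    have : 0 < x2 * (t3 - y2) := by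
      rw [f1]; exact mul_pos (by linarith) (by linarith)
    rw [hc]; exact (mul_pos_iff_of_pos_left hx2).1 this
  have hb0 : 0 < b := by
    have : 0 < x1 * (t2 - y1) := by
      rw [f3]; exact mul_pos (by linarith) (by linarith)
    rw [hb]; exact (mul_pos_iff_of_pos_left hx1).1 this
  have m1 : x1 - y2 = b + c + d := by linarith
  have m2 : x2 - y3 = a + c + d := by linarith
  have m3 : x3 - y1 = a + b + d := by linarith
  rw [m1, m2, ← hc] at f1
  rw [m2, m3, ← ha] at f2
  rw [m3, m1, ← hb] at f3
  have g1 : x2 = (a + b + c + 2 * d) + (a + d) * (b + d) / c := by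
    field_simp; linarith
  have g2 : x3 = (a + b + c + 2 * d) + (b + d) * (c + d) / a := by
    field_simp; linarith
  have g3 : x1 = (a + b + c + 2 * d) + (c + d) * (a + d) / b := by
    field_simp; linarith
  have key := main_ineq17 a b c d ha0 hb0 hc0 hd0
  have hX : x1 + x2 + x3 = 1 + (a + b + c + 2 * d) := by linarith
  obtain ⟨Z, hZ⟩ : ∃ Z, Z = a + b + c := ⟨_, rfl⟩
  rw [← hZ] at key
  have hZ0 : 0 < Z := by linarith
  have k2 : 3 * Z + 10 * d + 9 * d ^ 2 / Z ≤ 1 := by linarith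
  have hs : Real.sqrt 3 ^ 2 = 3 := Real.sq_sqrt (by norm_num)
  have hs0 : 0 ≤ Real.sqrt 3 := Real.sqrt_nonneg 3
  obtain ⟨s, hsd⟩ : ∃ s, s = Real.sqrt 3 := ⟨_, rfl⟩
  rw [← hsd] at hs hs0 ⊢
  have k3 : 6 * s * d ≤ 3 * Z + 9 * d ^ 2 / Z := by
    have : 3 * Z + 9 * d ^ 2 / Z - 6 * s * d = (s * Z - 3 * d) ^ 2 / Z := by
      field_simp
      linear_combination (-Z^2) * hs
    have h2 : 0 ≤ (s * Z - 3 * d) ^ 2 / Z := by positivity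
    linarith
  have k4 : d * (10 + 6 * s) ≤ 1 := by linarith
  have k5 : d ≤ (3 * s - 5) / 4 := by
    have : (3 * s - 5) / 4 * (10 + 6 * s) = 1 := by linear_combination (9/2) * hs
    have pos : 0 < 10 + 6 * s := by linarith
    rw [← this] at k4
    exact le_of_mul_le_mul_right k4 pos
  linarith

theorem Cfg17.main {x1 x2 x3 t1 t2 t3 y1 y2 y3 : ℝ}
    (h : Cfg17 x1 x2 x3 t1 t2 t3 y1 y2 y3) :
    3 * (3 - Real.sqrt 3) / 4 ≤ t1 + t2 + t3 := by
  rcases lt_trichotomy x1 y2 with a | a | a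
  · rcases lt_trichotomy x2 y3 with b | b | b
    · rcases lt_trichotomy x3 y1 with c | c | c
      · exact (h.caseNeg a b c).elim
      · exact (h.rot.rot.zero c).elim
      · exact (h.rot.rot.caseB c a b).elim
    · exact (h.rot.zero b).elim
    · rcases lt_trichotomy x3 y1 with c | c | c
      · exact (h.rot.caseB b c a).elim
      · exact (h.rot.rot.zero c).elim
      · exact (h.caseA a b c).elim
  · exact (h.zero a).elim
  · rcases lt_trichotomy x2 y3 with b | b | b
    · rcases lt_trichotomy x3 y1 with c | c | c
      · exact (h.caseB a b c).elim
      · exact (h.rot.rot.zero c).elim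
      · exact (h.rot.caseA b c a).elim
    · exact (h.rot.zero b).elim
    · rcases lt_trichotomy x3 y1 with c | c | c
      · exact (h.rot.rot.caseA c a b).elim
      · exact (h.rot.rot.zero c).elim
      · exact h.casePos a b c


/-- The optimization behind the three-triangle bound: if positive reals `x i, t i, y i`
(`i = 1,2,3`) satisfy `x i + t i + y i = 1` and the three collinearity equations, then
`t 1 + t 2 + t 3 ≥ (3(3-√3)/4) · min 1 (4/(3(3-√3)))`; in particular, if moreover
`t 1 + t 2 + t 3 < 1`, then `t 1 + t 2 + t 3 ≥ 3(3-√3)/4`, i.e.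
`1/(t 1 + t 2 + t 3) ≤ 2/3 + 2/(3√3)`. -/
theorem stmt_17 (x t y : Fin 3 → ℝ)
    (hx : ∀ i, 0 < x i) (ht : ∀ i, 0 < t i) (hy : ∀ i, 0 < y i)
    (hsum : ∀ i, x i + t i + y i = 1)
    (e1 : t 2 * x 1 + x 0 * y 2 - x 0 * x 1 - y 1 * y 2 = 0)
    (e2 : t 0 * x 2 + x 1 * y 0 - x 1 * x 2 - y 0 * y 2 = 0)
    (e3 : t 1 * x 0 + x 2 * y 1 - x 0 * x 2 - y 0 * y 1 = 0) :
    3 * (3 - Real.sqrt 3) / 4 * min 1 (4 / (3 * (3 - Real.sqrt 3))) ≤ t 0 + t 1 + t 2 ∧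
      (t 0 + t 1 + t 2 < 1 →
        3 * (3 - Real.sqrt 3) / 4 ≤ t 0 + t 1 + t 2 ∧
          1 / (t 0 + t 1 + t 2) ≤ 2 / 3 + 2 / (3 * Real.sqrt 3)) := by
  have hs : Real.sqrt 3 ^ 2 = 3 := Real.sq_sqrt (by norm_num)
  have hs0 : 0 < Real.sqrt 3 := Real.sqrt_pos.2 (by norm_num)
  have hs1 : 5 / 3 ≤ Real.sqrt 3 := Real.le_sqrt_of_sq_le (by norm_num)
  have hs2 : Real.sqrt 3 < 3 := by nlinarith
  have main : t 0 + t 1 + t 2 < 1 → 3 * (3 - Real.sqrt 3) / 4 ≤ t 0 + t 1 + t 2 := by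
    intro hT
    have h : Cfg17 (x 0) (x 1) (x 2) (t 0) (t 1) (t 2) (y 0) (y 1) (y 2) :=
      ⟨hx 0, hx 1, hx 2, ht 0, ht 1, ht 2, hy 0, hy 1, hy 2, hsum 0, hsum 1, hsum 2,
        by linarith, by linarith, by linarith, hT⟩
    exact h.main
  refine ⟨?_, fun hT => ⟨main hT, ?_⟩⟩
  · have hc : 0 ≤ 3 * (3 - Real.sqrt 3) / 4 := by linarith
    have h1 : 3 * (3 - Real.sqrt 3) / 4 * min 1 (4 / (3 * (3 - Real.sqrt 3))) ≤
        3 * (3 - Real.sqrt 3) / 4 * 1 := mul_le_mul_of_nonneg_left (min_le_left _ _) hc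
    rcases lt_or_ge (t 0 + t 1 + t 2) 1 with hT | hT
    · linarith [main hT]
    · linarith
  · have hm := main hT
    have hc : 0 < 3 * (3 - Real.sqrt 3) / 4 := by linarith
    have h1 := one_div_le_one_div_of_le hc hm
    have h2 : 1 / (3 * (3 - Real.sqrt 3) / 4) = 2 / 3 + 2 / (3 * Real.sqrt 3) := by
      have : 3 - Real.sqrt 3 ≠ 0 := by linarith
      field_simp
      linear_combination 2 * hs
    linarith
end
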